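/- Let I, J be finite subsets of ℕ with I ≺ J (transitive closure of ≺′). Then max I ≤ max J, where maxima are taken in ℕ with a bottom element adjoined and max ∅ = ⊥; and if moreover max I = max J, then J ⊊ I. -/

import Mathlib

/-!
For finite subsets `I, J` of `ℕ`, let `∂(J)` (`delMax J`) denote `J` with its maximal
element removed.  Define `I ≺′ J` (`precStep I J`) to hold if either `J = I ∖ {a}` for some
`a ∈ I` with `a ≠ max I`, or `J ≠ ∅` and `I = ∂(J)`.  Let `≺` (`prec`) be the transitive
closure of `≺′`.

STATEMENT: if `I ≺ J` then `max I ≤ max J` (maxima taken in `WithBot ℕ`, `max ∅ = ⊥`),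
and if moreover `max I = max J`, then `J ⊊ I`.
-/

/-- `S` with its maximal element removed (`∅` if `S = ∅`). -/
def delMax (S : Finset ℕ) : Finset ℕ :=
  if h : S.Nonempty then S.erase (S.max' h) else ∅

/-- The relation `≺′`. -/
def precStep (I J : Finset ℕ) : Prop :=
  (∃ a ∈ I, (a : WithBot ℕ) ≠ I.max ∧ J = I.erase a) ∨ (J.Nonempty ∧ I = delMax J)

/-- The relation `≺`, the transitive closure of `≺′`. -/
def prec : Finset ℕ → Finset ℕ → Prop :=
  Relation.TransGen precStep

theorem max_delMax_lt {J : Finset ℕ} (hJ : J.Nonempty) : (delMax J).max < J.max := by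
  rw [delMax, dif_pos hJ, ← Finset.coe_max' hJ]
  refine (Finset.max_le fun x hx => ?_).lt_of_ne fun h => ?_
  · exact WithBot.coe_le_coe.2 (J.le_max' x (Finset.mem_of_mem_erase hx))
  · exact Finset.notMem_erase _ _ (Finset.mem_of_max h)

theorem max_erase_of_coe_ne_max {I : Finset ℕ} {a : ℕ} (ha : (a : WithBot ℕ) ≠ I.max) :
    (I.erase a).max = I.max := by
  refine le_antisymm (Finset.max_mono (I.erase_subset a)) (Finset.max_le fun x hx => ?_)
  have hI : I.Nonempty := ⟨x, hx⟩
  have hmax : I.max' hI ≠ a := fun h => ha (h ▸ Finset.coe_max' hI)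
  exact (WithBot.coe_le_coe.2 (I.le_max' x hx)).trans
    (Finset.le_max (Finset.mem_erase.2 ⟨hmax, I.max'_mem hI⟩))

theorem max_le_of_precStep {I J : Finset ℕ} (h : precStep I J) :
    I.max ≤ J.max ∧ (I.max = J.max → J ⊂ I) := by
  rcases h with ⟨a, ha, hne, rfl⟩ | ⟨hJ, rfl⟩
  · exact ⟨(max_erase_of_coe_ne_max hne).ge, fun _ => Finset.erase_ssubset ha⟩
  · exact ⟨(max_delMax_lt hJ).le, fun h => absurd h (max_delMax_lt hJ).ne⟩

theorem max_le_of_prec (I J : Finset ℕ) (h : prec I J) :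
    I.max ≤ J.max ∧ (I.max = J.max → J ⊂ I) := by
  induction h with
  | single h => exact max_le_of_precStep h
  | tail _ h ih =>
    obtain ⟨hle, hss⟩ := max_le_of_precStep h
    refine ⟨ih.1.trans hle, fun heq => ?_⟩
    have hIK := le_antisymm ih.1 (heq ▸ hle)
    exact (hss (hIK.symm.trans heq)).trans (ih.2 hIK)
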